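/- Let σ and τ be disjoint countable relational signatures, let 𝒞₁ and 𝒞₂ be strong amalgamation classes of finite σ-structures and finite τ-structures respectively, each with an ω-categorical Fraïssé limit, and suppose 𝒞₁ and 𝒞₂ both have the Ramsey property. Then the class 𝒞₁ ∧ 𝒞₂ of all finite (σ ∪ τ)-structures whose σ-reduct is in 𝒞₁ and whose τ-reduct is in 𝒞₂ also has the Ramsey property. -/

import Mathlib

open FirstOrder FirstOrder.Language CategoryTheory

universe u v u' v' w

/-- The partition arrow `C → (B)^A_r`: for every colouring of the embeddings of `A` into `C`
with `r` colours there is an embedding `g` of `B` into `C` such that the colouring is constant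
on the copies of `A` inside the copy `g[B]` of `B`. -/
def RamseyArrow {L : FirstOrder.Language.{u, v}} (A B C : Bundled.{w} L.Structure) (r : ℕ) : Prop :=
  ∀ χ : (A ↪[L] C) → Fin r, ∃ g : B ↪[L] C,
    ∀ f₁ f₂ : A ↪[L] B, χ (g.comp f₁) = χ (g.comp f₂)

/-- A class of structures has the Ramsey property if for all members `A, B` and all `r : ℕ`
there is a member `C` with `C → (B)^A_r`. -/
def IsRamseyClass {L : FirstOrder.Language.{u, v}} (K : Set (Bundled.{w} L.Structure)) : Prop :=
  ∀ A ∈ K, ∀ B ∈ K, ∀ r : ℕ, ∃ C ∈ K, RamseyArrow A B C r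

/-- A strong amalgamation class of finite structures: all members are finite, the class is
closed under isomorphisms and induced substructures (equivalently: every finite structure
embedding into a member is a member), it has countably many members up to isomorphism, and
every amalgamation diagram has a strong amalgam in the class. -/
def IsStrongAmalgamationClass {L : FirstOrder.Language.{u, v}} (K : Set (Bundled.{w} L.Structure)) :
    Prop :=
  (∀ A ∈ K, Finite A) ∧
  (∀ A ∈ K, ∀ B : Bundled.{w} L.Structure, Finite B → Nonempty (B ↪[L] A) → B ∈ K) ∧
  (∃ S : Set (Bundled.{w} L.Structure), S.Countable ∧
    ∀ A ∈ K, ∃ B ∈ S, Nonempty (A ≃[L] B)) ∧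
  (∀ A ∈ K, ∀ B₁ ∈ K, ∀ B₂ ∈ K, ∀ e₁ : A ↪[L] B₁, ∀ e₂ : A ↪[L] B₂,
    ∃ C ∈ K, ∃ f₁ : B₁ ↪[L] C, ∃ f₂ : B₂ ↪[L] C,
      f₁.comp e₁ = f₂.comp e₂ ∧
      Set.range ⇑f₁ ∩ Set.range ⇑f₂ = Set.range ⇑(f₁.comp e₁))

/-- The `σ`-reduct of a bundled `(σ ∪ τ)`-structure. -/
def sumReduct₁ {σ : FirstOrder.Language.{u, v}} {τ : FirstOrder.Language.{u', v'}}
    (A : Bundled.{w} (σ.sum τ).Structure) : Bundled.{w} σ.Structure :=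
  ⟨A.α, @LHom.reduct σ (σ.sum τ) (LHom.sumInl : σ →ᴸ σ.sum τ) A.α A.str⟩

/-- The `τ`-reduct of a bundled `(σ ∪ τ)`-structure. -/
def sumReduct₂ {σ : FirstOrder.Language.{u, v}} {τ : FirstOrder.Language.{u', v'}}
    (A : Bundled.{w} (σ.sum τ).Structure) : Bundled.{w} τ.Structure :=
  ⟨A.α, @LHom.reduct τ (σ.sum τ) (LHom.sumInr : τ →ᴸ σ.sum τ) A.α A.str⟩

/-- The class `𝒞₁ ∧ 𝒞₂` of all `(σ ∪ τ)`-structures whose `σ`-reduct is in `𝒞₁` and whose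
`τ`-reduct is in `𝒞₂` (the disjoint union `σ ∪ τ` of the signatures is modelled by `σ.sum τ`). -/
def AndClass {σ : FirstOrder.Language.{u, v}} {τ : FirstOrder.Language.{u', v'}}
    (K₁ : Set (Bundled.{w} σ.Structure)) (K₂ : Set (Bundled.{w} τ.Structure)) :
    Set (Bundled.{w} (σ.sum τ).Structure) :=
  {A | sumReduct₁ A ∈ K₁ ∧ sumReduct₂ A ∈ K₂}

/-- A structure `M` is ω-categorical if its complete first-order theory has exactly one
countably infinite model up to isomorphism. -/
def IsOmegaCategorical (L : FirstOrder.Language.{u, v}) (M : Type w) [L.Structure M] : Prop :=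
  ∃ N : Theory.ModelType.{u, v, w} (L.completeTheory M), Countable N ∧ Infinite N ∧
    ∀ N' : Theory.ModelType.{u, v, w} (L.completeTheory M),
      Countable N' → Infinite N' → Nonempty (N' ≃[L] N)

/-- `M` is the Fraïssé limit of the class `K`: a countable ultrahomogeneous structure whose
age (the class of finite structures embedding into it) is exactly `K`. -/
def IsFraisseLimitOf {L : FirstOrder.Language.{u, v}} (K : Set (Bundled.{w} L.Structure)) (M : Type w)
    [L.Structure M] : Prop :=
  Countable M ∧ L.IsUltrahomogeneous M ∧
    ∀ A : Bundled.{w} L.Structure, A ∈ K ↔ (Finite A ∧ Nonempty (A ↪[L] M))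

/-- The class `K` has an ω-categorical Fraïssé limit. -/
def HasOmegaCatFraisseLimit {L : FirstOrder.Language.{u, v}} (K : Set (Bundled.{w} L.Structure)) : Prop :=
  ∃ (M : Type w) (s : L.Structure M),
    @IsFraisseLimitOf L K M s ∧ @IsOmegaCategorical L M s

namespace FirstOrder.Language

variable {L : FirstOrder.Language.{u, v}}

/-- The structure on `X` in a relational language pulled back along a map `X → M`. -/
abbrev pullbackStructure [L.IsRelational] {X : Type*} {M : Type*} [L.Structure M] (f : X → M) :
    L.Structure X where
  funMap := fun g _ => isEmptyElim g
  RelMap := fun r x => Structure.RelMap r (f ∘ x)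

/-- In a relational language, an injective map preserving and reflecting all relations is an
embedding. -/
def Embedding.ofRel [L.IsRelational] {M N : Type*} [L.Structure M] [L.Structure N] (f : M → N)
    (hf : Function.Injective f)
    (h : ∀ {n : ℕ} (r : L.Relations n) (x : Fin n → M), Structure.RelMap r (f ∘ x) ↔ Structure.RelMap r x) :
    M ↪[L] N where
  toFun := f
  inj' := hf
  map_fun' := fun g _ => isEmptyElim g
  map_rel' := h

end FirstOrder.Language

/-- Given `C ∈ K` and finitely many labels `j : J`, there is a member of `K` extending `C` by a
duplicate of the point `q j` for every `j`, such that projecting the duplicates to the originals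
preserves and reflects relations on all tuples on which it is injective. -/
theorem IsStrongAmalgamationClass.exists_blowup {L : FirstOrder.Language.{u, v}} [L.IsRelational]
    {K : Set (Bundled.{w} L.Structure)} (hK : IsStrongAmalgamationClass K)
    {C : Bundled.{w} L.Structure} (hC : C ∈ K) (J : Type w) [Finite J] :
    ∀ q : J → C, ∃ D ∈ K, ∃ e : C ⊕ J → D, Function.Injective e ∧
      ∀ {n : ℕ} (r : L.Relations n) (x : Fin n → C ⊕ J),
        (∀ i j, Sum.elim id q (x i) = Sum.elim id q (x j) → x i = x j) →
        (Structure.RelMap r (e ∘ x) ↔ Structure.RelMap r (Sum.elim id q ∘ x)) := by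
  induction J using Finite.induction_empty_option with
  | of_equiv α ih =>
    rename_i I
    intro q
    obtain ⟨D, hD, e, he, h⟩ := ih (q ∘ α)
    have hq : ∀ y, Sum.elim id (q ∘ α) (Sum.map id α.symm y) = Sum.elim id q y := by
      rintro (c | j) <;> simp
    have hinj : Function.Injective (Sum.map (id : C → C) α.symm) :=
      Function.injective_id.sumMap α.symm.injective
    refine ⟨D, hD, e ∘ Sum.map id α.symm, he.comp hinj, fun r x hx => ?_⟩
    have := h r (Sum.map id α.symm ∘ x) fun i j hij => by
      simp only [Function.comp_apply, hq] at hij ⊢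
      rw [hx i j hij]
    rw [← Function.comp_assoc] at this
    convert this using 2
    funext i
    simp [hq]
  | h_empty =>
    intro q
    have : ∀ y : C ⊕ PEmpty, y = Sum.inl (Sum.elim id q y) := by
      rintro (c | j)
      · rfl
      · exact j.elim
    exact ⟨C, hC, Sum.elim id q, fun a b hab => by rw [this a, this b, hab], fun r x _ => Iff.rfl⟩
  | h_option ih =>
    rename_i J _
    intro q
    obtain ⟨hfin, hsub, -, hamalg⟩ := hK
    obtain ⟨D, hD, e, he, h⟩ := ih (q ∘ some)
    set c₀ : C := q none with hc₀
    let s : L.Structure {d : D // d ≠ e (Sum.inl c₀)} := pullbackStructure Subtype.val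
    let A : Bundled.{w} L.Structure := ⟨{d : D // d ≠ e (Sum.inl c₀)}, s⟩
    let ι : A ↪[L] D := Embedding.ofRel Subtype.val Subtype.val_injective fun _ _ => Iff.rfl
    have : Finite D := hfin D hD
    have hA : A ∈ K := hsub D hD A (Subtype.finite (α := D)) ⟨ι⟩
    obtain ⟨E, hE, f₁, f₂, hf, hrange⟩ := hamalg A hA D hD D hD ι ι
    have hagree : ∀ d, d ≠ e (Sum.inl c₀) → f₁ d = f₂ d := fun d hd =>
      DFunLike.congr_fun hf (⟨d, hd⟩ : A)
    have hnew : ∀ d, f₁ d ≠ f₂ (e (Sum.inl c₀)) := by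
      intro d hd
      have hmem : f₂ (e (Sum.inl c₀)) ∈ Set.range ⇑(f₁.comp ι) := by
        rw [← hrange]; exact ⟨⟨d, hd⟩, ⟨_, rfl⟩⟩
      rw [hf] at hmem
      obtain ⟨a, ha⟩ := hmem
      exact a.2 (f₂.injective ha)
    let ρ : C ⊕ Option J → C ⊕ J :=
      Sum.elim Sum.inl fun o => o.elim (Sum.inl c₀) Sum.inr
    have hρ : ∀ y, Sum.elim id (q ∘ some) (ρ y) = Sum.elim id q y := by
      rintro (c | _ | j) <;> simp [ρ, hc₀]
    let e' : C ⊕ Option J → E :=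
      Sum.elim (fun c => f₁ (e (Sum.inl c)))
        fun o => o.elim (f₂ (e (Sum.inl c₀))) fun j => f₁ (e (Sum.inr j))
    have he₁ : ∀ y, y ≠ Sum.inr none → e' y = f₁ (e (ρ y)) := by
      rintro (c | _ | j) hy <;> simp_all [e', ρ]
    have he₂ : ∀ y, y ≠ Sum.inl c₀ → e' y = f₂ (e (ρ y)) := by
      rintro (c | _ | j) hy
      · exact hagree _ fun h' => hy (by rw [Sum.inl.inj (he h')])
      · rfl
      · exact hagree _ fun h' => by simpa using he h'
    refine ⟨E, hE, e', ?_, ?_⟩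
    · rintro (c | _ | j) (c' | _ | j') hy
      · exact congrArg _ (Sum.inl.inj (he (f₁.injective hy)))
      · exact absurd hy (hnew _)
      · exact absurd (he (f₁.injective hy)) (by simp)
      · exact absurd hy.symm (hnew _)
      · rfl
      · exact absurd hy.symm (hnew _)
      · exact absurd (he (f₁.injective hy)) (by simp)
      · exact absurd hy (hnew _)
      · exact congrArg (fun j => Sum.inr (some j)) (Sum.inr.inj (he (f₁.injective hy)))
    · intro n r x hx
      have key := h r (ρ ∘ x) fun i j hij => by
        simp only [Function.comp_apply, hρ] at hij ⊢
        rw [hx i j hij]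
      have hcomp : Sum.elim id (q ∘ some) ∘ ρ ∘ x = Sum.elim id q ∘ x := funext fun i => hρ _
      rw [hcomp] at key
      rw [← key]
      by_cases hn : ∃ i, x i = Sum.inr none
      · obtain ⟨i, hi⟩ := hn
        have : e' ∘ x = f₂ ∘ e ∘ ρ ∘ x := funext fun j => he₂ _ fun hj => by
          have := hx i j (by simp [hi, hj, hc₀])
          simp [hi, hj] at this
        rw [this, f₂.map_rel]
      · push Not at hn
        have : e' ∘ x = f₁ ∘ e ∘ ρ ∘ x := funext fun j => he₁ _ (hn j)
        rw [this, f₁.map_rel]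

/-- For `C ∈ K`, any map `q : J → C` from a finite type lifts to a structure on `J` in `K` whose
relations agree with those of `C` on all tuples on which `q` is injective. -/
theorem IsStrongAmalgamationClass.exists_structure {L : FirstOrder.Language.{u, v}}
    [L.IsRelational] {K : Set (Bundled.{w} L.Structure)} (hK : IsStrongAmalgamationClass K)
    {C : Bundled.{w} L.Structure} (hC : C ∈ K) {J : Type w} [Finite J] (q : J → C) :
    ∃ s : L.Structure J, (⟨J, s⟩ : Bundled.{w} L.Structure) ∈ K ∧
      ∀ {n : ℕ} (r : L.Relations n) (x : Fin n → J),
        (∀ i j, q (x i) = q (x j) → x i = x j) →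
        (s.RelMap r x ↔ Structure.RelMap r (q ∘ x)) := by
  obtain ⟨D, hD, e, he, h⟩ := hK.exists_blowup hC J q
  let s : L.Structure J := pullbackStructure (e ∘ Sum.inr)
  refine ⟨s, hK.2.1 D hD ⟨J, s⟩ ‹_› ⟨?_⟩, fun r x hx => ?_⟩
  · exact Embedding.ofRel (e ∘ Sum.inr) (he.comp Sum.inr_injective) fun _ _ => Iff.rfl
  · exact h r (Sum.inr ∘ x) fun i j hij => congrArg Sum.inr (hx i j hij)

/-- The product Ramsey theorem for two Ramsey classes of finite structures. -/
theorem IsRamseyClass.exists_prod {σ : FirstOrder.Language.{u, v}}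
    {τ : FirstOrder.Language.{u', v'}} {K₁ : Set (Bundled.{w} σ.Structure)}
    {K₂ : Set (Bundled.{w} τ.Structure)} (hr₁ : IsRamseyClass K₁) (hr₂ : IsRamseyClass K₂)
    (hfin : ∀ A ∈ K₂, Finite A)
    {A₁ B₁ : Bundled.{w} σ.Structure} {A₂ B₂ : Bundled.{w} τ.Structure}
    (hA₁ : A₁ ∈ K₁) (hB₁ : B₁ ∈ K₁) (hA₂ : A₂ ∈ K₂) (hB₂ : B₂ ∈ K₂)
    (f₀ : A₁ ↪[σ] B₁) (r : ℕ) :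
    ∃ C₁ ∈ K₁, ∃ C₂ ∈ K₂, ∀ χ : (A₁ ↪[σ] C₁) → (A₂ ↪[τ] C₂) → Fin r,
      ∃ (g₁ : B₁ ↪[σ] C₁) (g₂ : B₂ ↪[τ] C₂), ∀ (f₁ f₁' : A₁ ↪[σ] B₁) (f₂ f₂' : A₂ ↪[τ] B₂),
        χ (g₁.comp f₁) (g₂.comp f₂) = χ (g₁.comp f₁') (g₂.comp f₂') := by
  obtain ⟨C₂, hC₂, hram₂⟩ := hr₂ A₂ hA₂ B₂ hB₂ r
  have := hfin A₂ hA₂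
  have := hfin C₂ hC₂
  have : Finite (A₂ ↪[τ] C₂) := Finite.of_injective _ DFunLike.coe_injective
  obtain ⟨k, ⟨φ⟩⟩ := Finite.exists_equiv_fin ((A₂ ↪[τ] C₂) → Fin r)
  obtain ⟨C₁, hC₁, hram₁⟩ := hr₁ A₁ hA₁ B₁ hB₁ k
  refine ⟨C₁, hC₁, C₂, hC₂, fun χ => ?_⟩
  obtain ⟨g₁, hg₁⟩ := hram₁ fun f => φ (χ f)
  obtain ⟨g₂, hg₂⟩ := hram₂ (χ (g₁.comp f₀))
  have hconst : ∀ f, χ (g₁.comp f) = χ (g₁.comp f₀) := fun f => φ.injective (hg₁ f f₀)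
  refine ⟨g₁, g₂, fun f₁ f₁' f₂ f₂' => ?_⟩
  rw [hconst f₁, hconst f₁', hg₂ f₂ f₂']

section Superposition

variable {σ : FirstOrder.Language.{u, v}} {τ : FirstOrder.Language.{u', v'}}

/-- The embedding of `σ`-reducts underlying an embedding of `(σ ∪ τ)`-structures. -/
def sumReduct₁Map {A B : Bundled.{w} (σ.sum τ).Structure} (f : A ↪[σ.sum τ] B) :
    sumReduct₁ A ↪[σ] sumReduct₁ B where
  toFun := f
  inj' := f.injective
  map_fun' := fun g x => f.map_fun (Sum.inl g : (σ.sum τ).Functions _) x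
  map_rel' := fun r x => f.map_rel (Sum.inl r : (σ.sum τ).Relations _) x

/-- The embedding of `τ`-reducts underlying an embedding of `(σ ∪ τ)`-structures. -/
def sumReduct₂Map {A B : Bundled.{w} (σ.sum τ).Structure} (f : A ↪[σ.sum τ] B) :
    sumReduct₂ A ↪[τ] sumReduct₂ B where
  toFun := f
  inj' := f.injective
  map_fun' := fun g x => f.map_fun (Sum.inr g : (σ.sum τ).Functions _) x
  map_rel' := fun r x => f.map_rel (Sum.inr r : (σ.sum τ).Relations _) x

end Superposition

/-- If `𝒞₁` and `𝒞₂` are strong amalgamation classes of finite structures with the Ramsey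
property, in disjoint countable relational signatures `σ` and `τ`, each having an
ω-categorical Fraïssé limit, then `𝒞₁ ∧ 𝒞₂` is also Ramsey. -/
theorem statement1 (σ : FirstOrder.Language.{u, v}) (τ : FirstOrder.Language.{u', v'})
    [σ.IsRelational] [τ.IsRelational] [Countable σ.Symbols] [Countable τ.Symbols]
    (K₁ : Set (Bundled.{w} σ.Structure)) (K₂ : Set (Bundled.{w} τ.Structure))
    (h₁ : IsStrongAmalgamationClass K₁) (h₂ : IsStrongAmalgamationClass K₂)
    (hl₁ : HasOmegaCatFraisseLimit K₁) (hl₂ : HasOmegaCatFraisseLimit K₂)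
    (hr₁ : IsRamseyClass K₁) (hr₂ : IsRamseyClass K₂) :
    IsRamseyClass (AndClass K₁ K₂) := by
  intro A hA B hB r
  by_cases hAB : Nonempty (A ↪[σ.sum τ] B)
  swap
  · exact ⟨B, hB, fun χ => ⟨Embedding.refl _ _, fun f => (hAB ⟨f⟩).elim⟩⟩
  obtain ⟨f₀⟩ := hAB
  obtain ⟨C₁, hC₁, C₂, hC₂, hC⟩ := hr₁.exists_prod hr₂ h₂.1 hA.1 hB.1 hA.2 hB.2
    (sumReduct₁Map f₀) r
  have := h₁.1 C₁ hC₁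
  have := h₂.1 C₂ hC₂
  obtain ⟨s₁, hs₁, hrel₁⟩ := h₁.exists_structure hC₁ (Prod.fst : C₁ × C₂ → C₁)
  obtain ⟨s₂, hs₂, hrel₂⟩ := h₂.exists_structure hC₂ (Prod.snd : C₁ × C₂ → C₂)
  let D : Bundled.{w} (σ.sum τ).Structure := ⟨C₁ × C₂, Language.sumStructure σ τ _⟩
  let pair : ∀ X : Bundled.{w} (σ.sum τ).Structure, (sumReduct₁ X ↪[σ] C₁) →
      (sumReduct₂ X ↪[τ] C₂) → (X ↪[σ.sum τ] D) := fun X f₁ f₂ =>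
    Embedding.ofRel (fun a => (f₁ a, f₂ a)) (fun a b hab => f₁.injective (congrArg Prod.fst hab))
      (by
        rintro n (R | R) x
        · refine (hrel₁ R (fun i => (f₁ (x i), f₂ (x i))) fun i j hij => ?_).trans
            (f₁.map_rel R x)
          have : x i = x j := f₁.injective hij
          simp [this]
        · refine (hrel₂ R (fun i => (f₁ (x i), f₂ (x i))) fun i j hij => ?_).trans
            (f₂.map_rel R x)
          have : x i = x j := f₂.injective hij
          simp [this])
  refine ⟨D, ⟨h₁.2.1 _ hs₁ _ (inferInstanceAs (Finite (C₁ × C₂))) ⟨?_⟩,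
    h₂.2.1 _ hs₂ _ (inferInstanceAs (Finite (C₁ × C₂))) ⟨?_⟩⟩, fun χ => ?_⟩
  · exact Embedding.ofRel (M := sumReduct₁ D) (N := C₁ × C₂) id Function.injective_id
      fun _ _ => Iff.rfl
  · exact Embedding.ofRel (M := sumReduct₂ D) (N := C₁ × C₂) id Function.injective_id
      fun _ _ => Iff.rfl
  · obtain ⟨g₁, g₂, hg⟩ := hC fun f₁ f₂ => χ (pair A f₁ f₂)
    exact ⟨pair B g₁ g₂, fun f f' =>
      hg (sumReduct₁Map f) (sumReduct₁Map f') (sumReduct₂Map f) (sumReduct₂Map f')⟩
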